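/- Every singular point other than the (d−1)-uple point O on a real normalized non-degenerate monoid surface is a real singularity of type A⁻, i.e., has real local normal form x₁² − x₂² + x₃^{n+1} for some n ≥ 1. -/

import Mathlib

open MvPolynomial

def SingularAt {R : Type*} [CommRing R] {n : ℕ} (F : MvPolynomial (Fin (n + 1)) R)
    (P : Fin (n + 1) → R) : Prop :=
  eval P F = 0 ∧ ∀ i, eval P (pderiv i F) = 0

noncomputable def localEq (F : MvPolynomial (Fin 4) ℝ) (P : Fin 4 → ℝ) (r : Fin 4) :
    MvPolynomial (Fin 3) ℝ :=
  aeval (r.succAboveCases (1 : MvPolynomial (Fin 3) ℝ)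
    (fun j => C (P (r.succAbove j) / P r) + X j)) F

/-- Right equivalence over `ℝ`: a real formal change of coordinates. -/
def RightEquivR (f g : MvPowerSeries (Fin 3) ℝ) : Prop :=
  ∃ e : MvPowerSeries (Fin 3) ℝ ≃ₐ[ℝ] MvPowerSeries (Fin 3) ℝ, e f = g

namespace Monoid12

theorem ringHom_inj_of_surj {A : Type*} [CommRing A] [IsNoetherianRing A] (s : A →+* A)
    (hs : Function.Surjective s) : Function.Injective s := by
  let K : ℕ →o Ideal A := ⟨fun n => RingHom.ker (s ^ n), by
    refine monotone_nat_of_le_succ fun n x hx => ?_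
    rw [RingHom.mem_ker] at hx ⊢
    rw [pow_succ', RingHom.mul_def, RingHom.comp_apply, hx, map_zero]⟩
  obtain ⟨n, hn⟩ := monotone_stabilizes_iff_noetherian.mpr ‹IsNoetherianRing A› K
  rw [injective_iff_map_eq_zero]
  intro x hx
  have hsn : Function.Surjective (s ^ n : A →+* A) := by
    rw [RingHom.coe_pow]; exact hs.iterate n
  obtain ⟨y, rfl⟩ := hsn x
  have h1 : y ∈ K (n + 1) := by
    change y ∈ RingHom.ker (s ^ (n + 1))
    rw [RingHom.mem_ker, pow_succ', RingHom.mul_def, RingHom.comp_apply, hx]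
  rw [← hn (n + 1) (Nat.le_succ n)] at h1
  exact h1

variable {n : ℕ}

theorem mem_span_X (G : MvPowerSeries (Fin n) ℝ) (hG : MvPowerSeries.constantCoeff G = 0) :
    G ∈ Ideal.span (Set.range (fun i : Fin n => (MvPowerSeries.X i : MvPowerSeries (Fin n) ℝ))) := by
  classical
  let H : Fin n → MvPowerSeries (Fin n) ℝ := fun i m =>
    if m i ≠ 0 ∧ ∀ j < i, m j = 0 then MvPowerSeries.coeff m G else 0
  have hc : ∀ i m, MvPowerSeries.coeff m (H i) =
    if m i ≠ 0 ∧ ∀ j < i, m j = 0 then MvPowerSeries.coeff m G else 0 := fun i m => rfl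
  have hs : G = ∑ i, H i := by
    ext m
    rw [map_sum]
    simp only [hc]
    by_cases hm : m = 0
    · subst hm
      simp only [Finsupp.coe_zero, Pi.zero_apply, ne_eq, not_true_eq_false, false_and, if_false,
        Finset.sum_const_zero]
      simpa using hG
    · have : ∃ i, m i ≠ 0 := by
        by_contra! h
        exact hm (Finsupp.ext h)
      obtain ⟨i, hi, hmin⟩ : ∃ i, m i ≠ 0 ∧ ∀ j < i, m j = 0 := by
        obtain ⟨i, hi, hm⟩ := WellFounded.has_min (wellFounded_lt (α := Fin n)) {i | m i ≠ 0} this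
        exact ⟨i, hi, fun j hj => by
          by_contra h
          exact hm j h hj⟩
      rw [Finset.sum_eq_single i]
      · rw [if_pos ⟨hi, hmin⟩]
      · intro j _ hj
        rw [if_neg]
        rintro ⟨h1, h2⟩
        rcases lt_or_gt_of_ne hj with h | h
        · exact h1 (hmin j h)
        · exact hi (h2 i h)
      · simp
  rw [hs]
  refine Ideal.sum_mem _ fun i _ => ?_
  have : (MvPowerSeries.X i : MvPowerSeries (Fin n) ℝ) ∣ H i := by
    rw [MvPowerSeries.X_dvd_iff]
    intro m hm
    rw [hc, if_neg]
    simp [hm]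
  exact Ideal.mem_of_dvd _ this (Ideal.subset_span ⟨i, rfl⟩)

/-- regular system of parameters -/
def Params (a : Fin n → MvPowerSeries (Fin n) ℝ) : Prop :=
  (∀ i, MvPowerSeries.constantCoeff (a i) = 0) ∧
    ∀ i, (MvPowerSeries.X i : MvPowerSeries (Fin n) ℝ) ∈ Ideal.span (Set.range a)

theorem Params.mem_span {a : Fin n → MvPowerSeries (Fin n) ℝ} (ha : Params a)
    {G : MvPowerSeries (Fin n) ℝ} (hG : MvPowerSeries.constantCoeff G = 0) :
    G ∈ Ideal.span (Set.range a) := by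
  refine (Ideal.span_le.mpr ?_) (mem_span_X G hG)
  rintro _ ⟨i, rfl⟩
  exact ha.2 i

theorem le_order_sum {ι : Type*} (s : Finset ι) (k : ℕ∞) (f : ι → MvPowerSeries (Fin n) ℝ)
    (h : ∀ i ∈ s, k ≤ (f i).order) : k ≤ (∑ i ∈ s, f i).order := by
  classical
  induction s using Finset.induction_on with
  | empty => simp
  | insert a s ha ih =>
    rw [Finset.sum_insert ha]
    refine le_trans (le_min (h _ (by simp)) (ih fun i hi => h i (by simp [hi])))
      MvPowerSeries.min_order_le_add

theorem le_order_sub {k : ℕ∞} {f g : MvPowerSeries (Fin n) ℝ}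
    (hf : k ≤ f.order) (hg : k ≤ g.order) : k ≤ (f - g).order := by
  rw [sub_eq_add_neg]
  refine le_trans (le_min hf ?_) MvPowerSeries.min_order_le_add
  rwa [MvPowerSeries.order_neg]

theorem le_order_mul' {k : ℕ} {f g : MvPowerSeries (Fin n) ℝ}
    (hf : MvPowerSeries.constantCoeff f = 0) (hg : (k : ℕ∞) ≤ g.order) :
    ((k + 1 : ℕ) : ℕ∞) ≤ (f * g).order := by
  refine le_trans ?_ MvPowerSeries.le_order_mul
  have := MvPowerSeries.one_le_order_iff_constCoeff_eq_zero.mpr hf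
  push_cast
  rw [add_comm]
  exact add_le_add this hg

theorem eq_zero_of_order {f : MvPowerSeries (Fin n) ℝ} (h : ∀ k : ℕ, (k : ℕ∞) ≤ f.order) :
    f = 0 := by
  rw [← MvPowerSeries.order_eq_top_iff]
  exact ENat.eq_top_iff_forall_ge.mpr h

theorem subst_order {a : Fin n → MvPowerSeries (Fin n) ℝ}
    (ha : ∀ i, MvPowerSeries.constantCoeff (a i) = 0) (f : MvPowerSeries (Fin n) ℝ) :
    f.order ≤ (f.subst a).order := by
  refine le_trans ?_ (MvPowerSeries.le_order_subst
    (MvPowerSeries.hasSubst_of_constantCoeff_zero ha) f)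
  have : 1 ≤ ⨅ i, (a i).order :=
    le_iInf fun i => MvPowerSeries.one_le_order_iff_constCoeff_eq_zero.mpr (ha i)
  calc f.order = 1 * f.order := (one_mul _).symm
    _ ≤ _ := by gcongr

noncomputable def approx (q : MvPowerSeries (Fin n) ℝ → Fin n → MvPowerSeries (Fin n) ℝ) :
    ℕ → MvPowerSeries (Fin n) ℝ → MvPowerSeries (Fin n) ℝ
  | 0, _ => 0
  | k + 1, G => MvPowerSeries.C (MvPowerSeries.constantCoeff G) +
      ∑ i, MvPowerSeries.X i * approx q k (q G i)

theorem ift {a : Fin n → MvPowerSeries (Fin n) ℝ} (ha : Params a) :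
    ∃ e : MvPowerSeries (Fin n) ℝ ≃ₐ[ℝ] MvPowerSeries (Fin n) ℝ,
      ∀ i, e (MvPowerSeries.X i) = a i := by
  have hsub := MvPowerSeries.hasSubst_of_constantCoeff_zero ha.1
  let s : MvPowerSeries (Fin n) ℝ →ₐ[ℝ] MvPowerSeries (Fin n) ℝ := MvPowerSeries.substAlgHom hsub
  have hsX : ∀ i, s (MvPowerSeries.X i) = a i := fun i => MvPowerSeries.substAlgHom_X hsub i
  have hso : ∀ f, f.order ≤ (s f).order := fun f => by
    simp only [s, MvPowerSeries.substAlgHom_apply]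
    exact subst_order ha.1 f
  have hsC : ∀ c, s (MvPowerSeries.C c) = MvPowerSeries.C c := fun c => s.commutes c
  have hq : ∀ G : MvPowerSeries (Fin n) ℝ, ∃ q : Fin n → MvPowerSeries (Fin n) ℝ,
      G = MvPowerSeries.C (MvPowerSeries.constantCoeff G) + ∑ i, a i * q i := by
    intro G
    have := ha.mem_span (G := G - MvPowerSeries.C (MvPowerSeries.constantCoeff G)) (by simp)
    rw [Ideal.mem_span_range_iff_exists_fun] at this
    obtain ⟨c, hc⟩ := this
    refine ⟨c, ?_⟩
    rw [← sub_eq_iff_eq_add', ← hc]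
    exact Finset.sum_congr rfl fun i _ => mul_comm _ _
  choose q hq using hq
  have h1 : ∀ (k : ℕ) G, (k : ℕ∞) ≤ (G - s (approx q k G)).order := by
    intro k
    induction k with
    | zero => simp
    | succ k ih =>
      intro G
      have : G - s (approx q (k + 1) G) = ∑ i, a i * (q G i - s (approx q k (q G i))) := by
        simp only [approx, map_add, map_sum, map_mul, hsX, hsC, mul_sub, Finset.sum_sub_distrib]
        nth_rw 1 [hq G]
        ring
      rw [this]
      exact le_order_sum _ _ _ fun i _ => le_order_mul' (ha.1 i) (ih _)
  have h2 : ∀ (k : ℕ) G, (k : ℕ∞) ≤ (approx q (k + 1) G - approx q k G).order := by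
    intro k
    induction k with
    | zero => simp
    | succ k ih =>
      intro G
      have : approx q (k + 1 + 1) G - approx q (k + 1) G = ∑ i, MvPowerSeries.X i *
          (approx q (k + 1) (q G i) - approx q k (q G i)) := by
        rw [approx, approx]
        simp only [mul_sub, Finset.sum_sub_distrib]
        ring
      rw [this]
      exact le_order_sum _ _ _ fun i _ => le_order_mul' (by simp) (ih _)
  have h3 : ∀ (k l : ℕ) G, (k : ℕ∞) ≤ (approx q (k + l) G - approx q k G).order := by
    intro k l G
    induction l with
    | zero => simp
    | succ l ih =>
      have := h2 (k + l) G
      have h' : (k : ℕ∞) ≤ (approx q (k + l + 1) G - approx q (k + l) G).order :=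
        le_trans (by simp) this
      have e : approx q (k + (l + 1)) G - approx q k G =
        (approx q (k + l + 1) G - approx q (k + l) G) + (approx q (k + l) G - approx q k G) := by
        rw [← add_assoc]; ring
      rw [e]
      exact le_trans (le_min h' ih) MvPowerSeries.min_order_le_add
  have hsurj : Function.Surjective s := by
    intro G
    let H : MvPowerSeries (Fin n) ℝ := fun m =>
      MvPowerSeries.coeff m (approx q (m.degree + 1) G)
    have hH : ∀ k : ℕ, (k : ℕ∞) ≤ (H - approx q k G).order := by
      intro k
      refine MvPowerSeries.nat_le_order fun m hm => ?_
      obtain ⟨l, hl⟩ := Nat.exists_eq_add_of_lt hm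
      have hk : k = (m.degree + 1) + l := by omega
      have := h3 (m.degree + 1) l G
      rw [← hk] at this
      have h0 := MvPowerSeries.coeff_of_lt_order (f := approx q k G - approx q (m.degree + 1) G)
        (d := m) (lt_of_lt_of_le (by exact_mod_cast Nat.lt_succ_self _) this)
      rw [map_sub] at h0 ⊢
      change MvPowerSeries.coeff m (approx q (m.degree + 1) G) - _ = 0
      linarith
    refine ⟨H, ?_⟩
    have : G - s H = 0 := by
      refine eq_zero_of_order fun k => ?_
      have e : G - s H = (G - s (approx q k G)) - s (H - approx q k G) := by
        rw [map_sub]; ring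
      rw [e]
      exact le_order_sub (h1 k G) ((hH k).trans (hso _))
    exact (sub_eq_zero.mp this).symm
  have hinj : Function.Injective s := ringHom_inj_of_surj s.toRingHom hsurj
  exact ⟨AlgEquiv.ofBijective s ⟨hinj, hsurj⟩, hsX⟩

theorem constantCoeff_equiv (e : MvPowerSeries (Fin n) ℝ ≃ₐ[ℝ] MvPowerSeries (Fin n) ℝ)
    {x : MvPowerSeries (Fin n) ℝ} (hx : MvPowerSeries.constantCoeff x = 0) :
    MvPowerSeries.constantCoeff (e x) = 0 := by
  by_contra h
  have h1 : IsUnit (e x) := MvPowerSeries.isUnit_iff_constantCoeff.mpr (isUnit_iff_ne_zero.mpr h)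
  have h2 : IsUnit x := by simpa using h1.map e.symm
  exact (isUnit_iff_ne_zero.mp (MvPowerSeries.isUnit_iff_constantCoeff.mp h2)) hx

theorem Params.map {a : Fin n → MvPowerSeries (Fin n) ℝ} (ha : Params a)
    (e : MvPowerSeries (Fin n) ℝ ≃ₐ[ℝ] MvPowerSeries (Fin n) ℝ) : Params (fun i => e (a i)) := by
  refine ⟨fun i => constantCoeff_equiv e (ha.1 i), fun i => ?_⟩
  have h1 : MvPowerSeries.constantCoeff (e.symm (MvPowerSeries.X i)) = 0 :=
    constantCoeff_equiv e.symm (by simp)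
  have h2 := Ideal.mem_map_of_mem e.toRingEquiv.toRingHom (ha.mem_span h1)
  rw [Ideal.map_span, ← Set.range_comp] at h2
  simpa [Function.comp_def] using h2

end Monoid12

namespace Monoid12
variable {n : ℕ}

theorem exists_root (m : ℕ) (hm : m ≠ 0) (ε : MvPowerSeries (Fin n) ℝ)
    (hε : 0 < MvPowerSeries.constantCoeff ε) :
    ∃ δ : MvPowerSeries (Fin n) ℝ, δ ^ m = ε := by
  set c := MvPowerSeries.constantCoeff ε with hc
  let B : PowerSeries ℝ := PowerSeries.binomialSeries ℝ ((m : ℝ)⁻¹)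
  have hB : ∀ k : ℕ, B ^ k = PowerSeries.binomialSeries ℝ (k * (m : ℝ)⁻¹) := by
    intro k
    induction k with
    | zero => simp
    | succ k ih =>
      rw [pow_succ, ih, ← PowerSeries.binomialSeries_add]
      congr 1
      push_cast; ring
  have hBm : B ^ m = 1 + PowerSeries.X := by
    rw [hB, mul_inv_cancel₀ (by exact_mod_cast hm)]
    have := PowerSeries.binomialSeries_nat (R := ℝ) (A := ℝ) 1
    simpa using this
  let x : MvPowerSeries (Fin n) ℝ := MvPowerSeries.C c⁻¹ * ε - 1
  have hx : MvPowerSeries.constantCoeff x = 0 := by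
    simp only [x, map_sub, map_mul, MvPowerSeries.constantCoeff_C, ← hc, map_one]
    rw [inv_mul_cancel₀ hε.ne', sub_self]
  have hs : PowerSeries.HasSubst x := PowerSeries.HasSubst.of_constantCoeff_zero hx
  let s : PowerSeries ℝ →ₐ[ℝ] MvPowerSeries (Fin n) ℝ := PowerSeries.substAlgHom hs
  have hsX : s PowerSeries.X = x := PowerSeries.substAlgHom_X hs
  have h1 : s B ^ m = MvPowerSeries.C c⁻¹ * ε := by
    rw [← map_pow, hBm, map_add, map_one, hsX]; ring
  refine ⟨MvPowerSeries.C (c ^ ((m : ℝ)⁻¹)) * s B, ?_⟩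
  rw [mul_pow, h1, ← map_pow, Real.rpow_inv_natCast_pow hε.le hm, ← mul_assoc, ← map_mul,
    mul_inv_cancel₀ hε.ne', map_one, one_mul]

/-- The class of series of the shape `u w + (unit) t ^ m`, for parameters `u, w, t`. -/
def KForm (m : ℕ) (F : MvPowerSeries (Fin 3) ℝ) : Prop :=
  ∃ (a : Fin 3 → MvPowerSeries (Fin 3) ℝ) (ε : MvPowerSeries (Fin 3) ℝ), Params a ∧
    IsUnit ε ∧ F = a 0 * a 1 + ε * a 2 ^ m

theorem KForm.map {m : ℕ} {F : MvPowerSeries (Fin 3) ℝ} (h : KForm m F)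
    (e : MvPowerSeries (Fin 3) ℝ ≃ₐ[ℝ] MvPowerSeries (Fin 3) ℝ) : KForm m (e F) := by
  obtain ⟨a, ε, ha, hε, rfl⟩ := h
  exact ⟨_, e ε, ha.map e, hε.map e, by simp⟩

theorem KForm.unit_mul {m : ℕ} {F : MvPowerSeries (Fin 3) ℝ} (h : KForm m F)
    {η : MvPowerSeries (Fin 3) ℝ} (hη : IsUnit η) : KForm m (η * F) := by
  obtain ⟨a, ε, ha, hε, rfl⟩ := h
  refine ⟨![η * a 0, a 1, a 2], η * ε, ⟨?_, ?_⟩, hη.mul hε, ?_⟩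
  · intro i
    fin_cases i <;> simp [ha.1]
  · intro i
    refine (Ideal.span_le.mpr ?_) (ha.2 i)
    rintro _ ⟨j, rfl⟩
    obtain ⟨η', hη'⟩ := hη.exists_left_inv
    fin_cases j
    · have : η * a 0 ∈ Ideal.span (Set.range ![η * a 0, a 1, a 2]) :=
        Ideal.subset_span ⟨0, rfl⟩
      have := Ideal.mul_mem_left _ η' this
      rw [← mul_assoc, hη', one_mul] at this
      exact this
    · exact Ideal.subset_span ⟨1, rfl⟩
    · exact Ideal.subset_span ⟨2, rfl⟩
  · simp; ring

theorem KForm.normal {m : ℕ} (hm : m ≠ 0) {F : MvPowerSeries (Fin 3) ℝ} (h : KForm m F) :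
    (∃ e : MvPowerSeries (Fin 3) ℝ ≃ₐ[ℝ] MvPowerSeries (Fin 3) ℝ, e F =
      (MvPowerSeries.X 0) ^ 2 - (MvPowerSeries.X 1) ^ 2 + (MvPowerSeries.X 2) ^ m) ∨
    (∃ e : MvPowerSeries (Fin 3) ℝ ≃ₐ[ℝ] MvPowerSeries (Fin 3) ℝ, e F =
      -((MvPowerSeries.X 0) ^ 2 - (MvPowerSeries.X 1) ^ 2 + (MvPowerSeries.X 2) ^ m)) := by
  obtain ⟨a, ε, ha, hε, rfl⟩ := h
  have h2 : (MvPowerSeries.C (2⁻¹ : ℝ) : MvPowerSeries (Fin 3) ℝ) * 2 = 1 := by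
    have : (2 : MvPowerSeries (Fin 3) ℝ) = MvPowerSeries.C 2 := (map_ofNat _ 2).symm
    rw [this, ← map_mul]; norm_num
  have key : ∀ (s : ℝ) (δ : MvPowerSeries (Fin 3) ℝ), s ^ 2 = 1 → IsUnit δ →
      ∃ e : MvPowerSeries (Fin 3) ℝ ≃ₐ[ℝ] MvPowerSeries (Fin 3) ℝ,
        e (a 0 * a 1 + MvPowerSeries.C s * δ ^ m * a 2 ^ m) = MvPowerSeries.C s *
        ((MvPowerSeries.X 0) ^ 2 - (MvPowerSeries.X 1) ^ 2 + (MvPowerSeries.X 2) ^ m) := by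
    intro s δ hs hδ
    set σ : MvPowerSeries (Fin 3) ℝ := MvPowerSeries.C s with hσ
    have hσ2 : σ ^ 2 = 1 := by rw [hσ, ← map_pow, hs, map_one]
    set κ : MvPowerSeries (Fin 3) ℝ := MvPowerSeries.C (2⁻¹ : ℝ) with hκ
    let b : Fin 3 → MvPowerSeries (Fin 3) ℝ :=
      ![κ * (a 0 + σ * a 1), κ * (a 0 - σ * a 1), δ * a 2]
    have hb : Params b := by
      refine ⟨?_, ?_⟩
      · intro i
        fin_cases i <;> simp [ha.1, b]
      · intro i
        refine (Ideal.span_le.mpr ?_) (ha.2 i)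
        have b0 : b 0 ∈ Ideal.span (Set.range b) := Ideal.subset_span ⟨0, rfl⟩
        have b1 : b 1 ∈ Ideal.span (Set.range b) := Ideal.subset_span ⟨1, rfl⟩
        have b2 : b 2 ∈ Ideal.span (Set.range b) := Ideal.subset_span ⟨2, rfl⟩
        obtain ⟨δ', hδ'⟩ := hδ.exists_left_inv
        rintro _ ⟨j, rfl⟩
        fin_cases j
        · have e : a 0 = b 0 + b 1 := by
            simp only [b, Matrix.cons_val_zero, Matrix.cons_val_one]
            linear_combination (-a 0) * h2
          change a 0 ∈ _
          rw [e]
          exact Ideal.add_mem _ b0 b1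
        · have e : a 1 = σ * (b 0 - b 1) := by
            simp only [b, Matrix.cons_val_zero, Matrix.cons_val_one]
            linear_combination (-a 1) * h2 - κ * 2 * a 1 * hσ2
          change a 1 ∈ _
          rw [e]
          exact Ideal.mul_mem_left _ _ (Ideal.sub_mem _ b0 b1)
        · have e : a 2 = δ' * b 2 := by
            simp only [b, Matrix.cons_val]
            linear_combination (-a 2) * hδ'
          change a 2 ∈ _
          rw [e]
          exact Ideal.mul_mem_left _ _ b2
    obtain ⟨e, he⟩ := ift hb
    refine ⟨e.symm, ?_⟩
    rw [AlgEquiv.symm_apply_eq]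
    have heσ : e σ = σ := e.commutes s
    simp only [map_mul, map_add, map_sub, map_pow, he, heσ]
    simp only [b, Matrix.cons_val_zero, Matrix.cons_val_one, Matrix.cons_val]
    rw [mul_pow δ]
    linear_combination (-(a 0 * a 1) * (κ * 2 + 1)) * h2 -4 * κ^2 * a 0 * a 1 * hσ2
  have h0 : MvPowerSeries.constantCoeff ε ≠ 0 :=
    isUnit_iff_ne_zero.mp (MvPowerSeries.isUnit_iff_constantCoeff.mp hε)
  rcases lt_or_gt_of_ne h0 with h | h
  · right
    obtain ⟨δ, hδ⟩ := exists_root m hm (-ε) (by simpa using h)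
    have hu : IsUnit δ := (isUnit_pow_iff hm).mp (hδ ▸ hε.neg)
    obtain ⟨e, he⟩ := key (-1) δ (by norm_num) hu
    refine ⟨e, ?_⟩
    rw [hδ] at he
    simpa using he
  · left
    obtain ⟨δ, hδ⟩ := exists_root m hm ε h
    have hu : IsUnit δ := (isUnit_pow_iff hm).mp (hδ ▸ hε)
    obtain ⟨e, he⟩ := key 1 δ (by norm_num) hu
    refine ⟨e, ?_⟩
    rw [hδ] at he
    simpa using he

end Monoid12

namespace Monoid12

theorem aeval_smul_homog {σ A : Type*} [CommRing A] [Algebra ℝ A] {F : MvPolynomial σ ℝ} {d : ℕ}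
    (hF : F.IsHomogeneous d) (v : A) (x : σ → A) :
    aeval (fun i => v * x i) F = v ^ d * aeval x F := by
  rw [aeval_def, aeval_def, eval₂_eq, eval₂_eq, Finset.mul_sum]
  refine Finset.sum_congr rfl fun m hm => ?_
  have : v ^ d = ∏ i ∈ m.support, v ^ m i := by
    rw [Finset.prod_pow_eq_pow_sum, hF.degree_eq_sum_deg_support hm]
  rw [this]
  simp only [mul_pow, Finset.prod_mul_distrib]
  ring

theorem coe_aeval {σ : Type*} {n : ℕ} (x : σ → MvPolynomial (Fin n) ℝ) (F : MvPolynomial σ ℝ) :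
    ((aeval x F : MvPolynomial (Fin n) ℝ) : MvPowerSeries (Fin n) ℝ) =
      aeval (fun i => ((x i : MvPolynomial (Fin n) ℝ) : MvPowerSeries (Fin n) ℝ)) F := by
  have := comp_aeval_apply (f := x) (coeToMvPowerSeries.algHom (R := ℝ) (σ := Fin n) ℝ) F
  simpa [coeToMvPowerSeries.algHom_apply] using this

noncomputable def chartPt (P : Fin 4 → ℝ) (r : Fin 4) (i : Fin 4) : MvPowerSeries (Fin 3) ℝ :=
  ((r.succAboveCases (1 : MvPolynomial (Fin 3) ℝ)
    (fun j => C (P (r.succAbove j) / P r) + X j) i : MvPolynomial (Fin 3) ℝ) :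
      MvPowerSeries (Fin 3) ℝ)

theorem chartPt_self (P : Fin 4 → ℝ) (r : Fin 4) : chartPt P r r = 1 := by
  simp [chartPt]

theorem chartPt_succAbove (P : Fin 4 → ℝ) (r : Fin 4) (j : Fin 3) :
    chartPt P r (r.succAbove j) =
      MvPowerSeries.C (P (r.succAbove j) / P r) + MvPowerSeries.X j := by
  simp [chartPt]

theorem coe_localEq (F : MvPolynomial (Fin 4) ℝ) (P : Fin 4 → ℝ) (r : Fin 4) :
    (localEq F P r : MvPowerSeries (Fin 3) ℝ) = aeval (chartPt P r) F := by
  rw [localEq, coe_aeval]; rfl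

theorem chartPt_const (P : Fin 4 → ℝ) (r i : Fin 4) (hr : P r ≠ 0) :
    MvPowerSeries.constantCoeff (chartPt P r i) = P i / P r := by
  rcases Fin.eq_self_or_eq_succAbove r i with rfl | ⟨j, rfl⟩
  · rw [chartPt_self]; simp [hr]
  · rw [chartPt_succAbove]; simp

theorem chart_transport {F : MvPolynomial (Fin 4) ℝ} {d : ℕ} (hF : F.IsHomogeneous d)
    (P : Fin 4 → ℝ) {r r' : Fin 4} (hr : P r ≠ 0) (hr' : P r' ≠ 0) {m : ℕ}
    (h : KForm m (localEq F P r : MvPowerSeries (Fin 3) ℝ)) :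
    KForm m (localEq F P r' : MvPowerSeries (Fin 3) ℝ) := by
  have hcu : IsUnit (chartPt P r r') := by
    rw [MvPowerSeries.isUnit_iff_constantCoeff, chartPt_const P r r' hr]
    exact isUnit_iff_ne_zero.mpr (div_ne_zero hr' hr)
  obtain ⟨v, hv⟩ := hcu.exists_left_inv
  have hvc : MvPowerSeries.constantCoeff v * (P r' / P r) = 1 := by
    rw [← chartPt_const P r r' hr, ← map_mul, hv, map_one]
  have hvu : IsUnit v := IsUnit.of_mul_eq_one _ hv
  let a : Fin 3 → MvPowerSeries (Fin 3) ℝ := fun j =>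
    v * chartPt P r (r'.succAbove j) - MvPowerSeries.C (P (r'.succAbove j) / P r')
  have ha : Params a := by
    constructor
    · intro j
      simp only [a, map_sub, map_mul, chartPt_const P r _ hr, MvPowerSeries.constantCoeff_C]
      have : MvPowerSeries.constantCoeff v = P r / P r' := by
        field_simp at hvc ⊢; linarith
      rw [this]; field_simp; ring
    · have h1 : ∀ i, chartPt P r i - MvPowerSeries.C (P i / P r') * chartPt P r r' ∈
          Ideal.span (Set.range a) := by
        intro i
        rcases Fin.eq_self_or_eq_succAbove r' i with rfl | ⟨j, rfl⟩
        · rw [div_self hr']; simp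
        · have : chartPt P r (r'.succAbove j) -
              MvPowerSeries.C (P (r'.succAbove j) / P r') * chartPt P r r' =
              chartPt P r r' * a j := by
            simp only [a]
            linear_combination (-chartPt P r (r'.succAbove j)) * hv
          rw [this]
          exact Ideal.mul_mem_left _ _ (Ideal.subset_span ⟨j, rfl⟩)
      intro j
      have h2 := h1 r
      rw [chartPt_self] at h2
      have h3 := Ideal.sub_mem _ (h1 (r.succAbove j))
        (Ideal.mul_mem_left _ (MvPowerSeries.C (P (r.succAbove j) / P r)) h2)
      have h4 : (MvPowerSeries.C (P (r.succAbove j) / P r') : MvPowerSeries (Fin 3) ℝ) =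
        MvPowerSeries.C (P (r.succAbove j) / P r) * MvPowerSeries.C (P r / P r') := by
        rw [← map_mul]; congr 1; field_simp
      convert h3 using 1
      rw [chartPt_succAbove, h4]
      ring
  obtain ⟨e, he⟩ := ift ha
  have he2 : ∀ i, e (chartPt P r' i) = v * chartPt P r i := by
    intro i
    rcases Fin.eq_self_or_eq_succAbove r' i with rfl | ⟨j, rfl⟩
    · rw [chartPt_self, map_one, hv]
    · rw [chartPt_succAbove, map_add, he]
      have : e (MvPowerSeries.C (P (r'.succAbove j) / P r')) =
        MvPowerSeries.C (P (r'.succAbove j) / P r') := e.commutes _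
      rw [this]
      simp only [a]; ring
  have key : e (localEq F P r' : MvPowerSeries (Fin 3) ℝ) = v ^ d * localEq F P r := by
    rw [coe_localEq, coe_localEq, ← aeval_smul_homog hF]
    have := comp_aeval_apply (f := chartPt P r') (e : _ →ₐ[ℝ] MvPowerSeries (Fin 3) ℝ) F
    simp only [AlgEquiv.coe_toAlgHom] at this
    rw [this]
    congr 2
    ext1 i
    exact he2 i
  have := (h.unit_mul (hvu.pow d)).map e.symm
  rw [← key, AlgEquiv.symm_apply_apply] at this
  exact this

end Monoid12

namespace Monoid12

theorem gauss_bezout {D : Type*} [CommRing D] [IsDomain D] [UniqueFactorizationMonoid D]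
    {f g : Polynomial D} (hf : f ≠ 0) (h : IsRelPrime f g) :
    ∃ (a b : Polynomial D) (c : D), c ≠ 0 ∧ a * f + b * g = Polynomial.C c := by
  classical
  let _ : NormalizedGCDMonoid D := Nonempty.some inferInstance
  let K := FractionRing D
  have hinj : Function.Injective (algebraMap D K) := IsFractionRing.injective D K
  have hrel : IsRelPrime (f.map (algebraMap D K)) (g.map (algebraMap D K)) := by
    intro p hpf hpg
    have hp0 : p ≠ 0 := by
      rintro rfl
      rw [zero_dvd_iff, Polynomial.map_eq_zero_iff hinj] at hpf
      exact hf hpf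
    set p' := (IsLocalization.integerNormalization (nonZeroDivisors D) p) with hp'
    obtain ⟨c, c0, hc⟩ := IsLocalization.integerNormalization_spec (nonZeroDivisors D) p
    have hc0 : algebraMap D K c ≠ 0 := by
      simpa using nonZeroDivisors.ne_zero c0
    have hd : p'.primPart.map (algebraMap D K) ∣ p := by
      have h1 : p'.primPart.map (algebraMap D K) ∣ p'.map (algebraMap D K) :=
        Polynomial.map_dvd _ p'.primPart_dvd
      rw [hc, Algebra.smul_def, Polynomial.algebraMap_apply] at h1
      exact (IsUnit.dvd_mul_left (Polynomial.isUnit_C.mpr (isUnit_iff_ne_zero.mpr hc0))).mp h1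
    have hprim := p'.isPrimitive_primPart
    have hu := h (hprim.dvd_of_fraction_map_dvd_fraction_map (hd.trans hpf))
      (hprim.dvd_of_fraction_map_dvd_fraction_map (hd.trans hpg))
    exact Polynomial.isUnit_or_eq_zero_of_isUnit_integerNormalization_primPart hp0 hu
  obtain ⟨a, b, hab⟩ := hrel.isCoprime
  obtain ⟨c1, hc1, ha⟩ := IsLocalization.integerNormalization_spec (nonZeroDivisors D) a
  obtain ⟨c2, hc2, hb⟩ := IsLocalization.integerNormalization_spec (nonZeroDivisors D) b
  refine ⟨Polynomial.C c2 * IsLocalization.integerNormalization (nonZeroDivisors D) a,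
    Polynomial.C c1 * IsLocalization.integerNormalization (nonZeroDivisors D) b, c1 * c2,
    mul_ne_zero (nonZeroDivisors.ne_zero hc1) (nonZeroDivisors.ne_zero hc2), ?_⟩
  apply Polynomial.map_injective _ hinj
  simp only [Polynomial.map_add, Polynomial.map_mul, ha, hb, Polynomial.map_C, Algebra.smul_def,
    Polynomial.algebraMap_apply, map_mul]
  linear_combination (Polynomial.C (algebraMap D K c1) * Polynomial.C (algebraMap D K c2)) * hab

theorem finSucc_aux (c : MvPolynomial (Fin 2) ℝ) :
    finSuccEquiv ℝ 2 (rename Fin.succ c) = Polynomial.C c := by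
  induction c using MvPolynomial.induction_on with
  | C r => simp [finSuccEquiv_apply]
  | add p q hp hq => rw [map_add, map_add, map_add, hp, hq]
  | mul_X p i hp => rw [map_mul, map_mul, map_mul, hp, rename_X, finSuccEquiv_X_succ]

theorem bezout3 {f g : MvPolynomial (Fin 3) ℝ} (hf : f ≠ 0) (h : IsRelPrime f g)
    (π : Equiv.Perm (Fin 3)) :
    ∃ (a b : MvPolynomial (Fin 3) ℝ) (c : MvPolynomial (Fin 2) ℝ), c ≠ 0 ∧
      a * f + b * g = rename (fun i : Fin 2 => π i.succ) c := by
  let Ψ : MvPolynomial (Fin 3) ℝ ≃ₐ[ℝ] Polynomial (MvPolynomial (Fin 2) ℝ) :=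
    (renameEquiv ℝ π.symm).trans (finSuccEquiv ℝ 2)
  have h1 : IsRelPrime (Ψ f) (Ψ g) := by
    intro p hp hq
    have h2 : Ψ.symm p ∣ f := by simpa using map_dvd Ψ.symm hp
    have h3 : Ψ.symm p ∣ g := by simpa using map_dvd Ψ.symm hq
    simpa using (h h2 h3).map Ψ
  obtain ⟨a, b, c, hc, hab⟩ := gauss_bezout (by simpa using hf) h1
  refine ⟨Ψ.symm a, Ψ.symm b, c, hc, ?_⟩
  apply Ψ.injective
  simp only [map_add, map_mul, AlgEquiv.apply_symm_apply, hab]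
  simp only [Ψ, AlgEquiv.trans_apply, renameEquiv_apply, rename_rename]
  have : (π.symm ∘ fun i : Fin 2 => π i.succ) = Fin.succ := by ext i; simp
  rw [this, finSucc_aux]

theorem curve_contra {f g : MvPolynomial (Fin 3) ℝ} {d1 d2 : ℕ} (hf0 : f ≠ 0)
    (h : IsRelPrime f g) (hf : f.IsHomogeneous d1) (hg : g.IsHomogeneous d2)
    (ρ : Fin 3 → PowerSeries ℝ) (k j : Fin 3) (hkj : k ≠ j) (β : ℝ) (hk : ρ k = 1)
    (hj : ρ j = PowerSeries.C β + PowerSeries.X)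
    (h1 : aeval ρ f = 0) (h2 : aeval ρ g = 0) : False := by
  obtain ⟨π, hπk, hπj⟩ : ∃ π : Equiv.Perm (Fin 3), π 1 = k ∧ π 2 = j := by
    clear hk hj
    revert k j; decide
  obtain ⟨a, b, c, hc, hab⟩ := bezout3 hf0 h π
  apply hc
  let τ : Fin 2 → Polynomial ℝ := ![1, Polynomial.C β + Polynomial.X]
  have hτ : ∀ i, ρ (π i.succ) = (τ i : PowerSeries ℝ) := by
    intro i
    fin_cases i
    · simpa [τ, hπk] using hk
    · simpa [τ, hπj] using hj
  have hz : ∀ s : ℝ, aeval (fun i => Polynomial.C s * τ i) c = 0 := by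
    intro s
    have e1 := congrArg (aeval (fun i => PowerSeries.C s * ρ i)) hab
    rw [map_add, map_mul, map_mul, aeval_smul_homog hf, aeval_smul_homog hg, h1, h2,
      aeval_rename] at e1
    have e2 := comp_aeval_apply (f := fun i => Polynomial.C s * τ i)
      (Polynomial.coeToPowerSeries.algHom (R := ℝ) ℝ) c
    have e3 : (fun i => (Polynomial.coeToPowerSeries.algHom (R := ℝ) ℝ) (Polynomial.C s * τ i)) =
      ((fun i => PowerSeries.C s * ρ i) ∘ fun i : Fin 2 => π i.succ) := by
      funext i
      simp [Polynomial.coeToPowerSeries.algHom_apply, hτ]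
    rw [e3, ← e1] at e2
    simpa [Polynomial.coeToPowerSeries.algHom_apply] using e2
  have hX : X 0 * c = 0 := by
    apply MvPolynomial.funext
    intro x
    rw [map_mul, eval_X, map_zero]
    by_cases hx : x 0 = 0
    · simp [hx]
    · have e1 := congrArg (Polynomial.aeval (x 1 / x 0 - β)) (hz (x 0))
      rw [comp_aeval_apply, map_zero] at e1
      have : (fun i => Polynomial.aeval (x 1 / x 0 - β) (Polynomial.C (x 0) * τ i)) = x := by
        funext i
        fin_cases i
        · simp [τ]
        · simp [τ]; field_simp
      rw [this] at e1
      have e4 : eval x c = 0 := by rw [← e1, aeval_eq_eval]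
      rw [e4, mul_zero]
  exact (mul_eq_zero.mp hX).resolve_left (X_ne_zero 0)

end Monoid12

namespace Monoid12

theorem lin_mul {n : ℕ} (l : Fin n) (x y : MvPowerSeries (Fin n) ℝ) :
    MvPowerSeries.coeff (Finsupp.single l 1) (x * y) =
      MvPowerSeries.constantCoeff x * MvPowerSeries.coeff (Finsupp.single l 1) y +
      MvPowerSeries.coeff (Finsupp.single l 1) x * MvPowerSeries.constantCoeff y := by
  classical
  rw [MvPowerSeries.coeff_mul, Finsupp.antidiagonal_single, Finset.sum_map,
    Finset.Nat.sum_antidiagonal_eq_sum_range_succ_mk]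
  simp [Finset.sum_range_succ]

theorem lin_X {n : ℕ} (l i : Fin n) :
    MvPowerSeries.coeff (Finsupp.single l 1) (MvPowerSeries.X i : MvPowerSeries (Fin n) ℝ) =
      if l = i then 1 else 0 := by
  classical
  rw [MvPowerSeries.coeff_X]
  simp [Finsupp.single_left_inj]

theorem lin_C {n : ℕ} (l : Fin n) (c : ℝ) :
    MvPowerSeries.coeff (Finsupp.single l 1) (MvPowerSeries.C c : MvPowerSeries (Fin n) ℝ) = 0 := by
  classical
  rw [MvPowerSeries.coeff_C]
  simp

theorem split_lemma (p h : MvPolynomial (Fin 2) ℝ) (i j : Fin 2) (hij : i ≠ j)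
    (hp0 : MvPowerSeries.constantCoeff (p : MvPowerSeries (Fin 2) ℝ) = 0)
    (hpi : MvPowerSeries.coeff (Finsupp.single i 1) (p : MvPowerSeries (Fin 2) ℝ) ≠ 0)
    (hh0 : MvPowerSeries.constantCoeff (h : MvPowerSeries (Fin 2) ℝ) = 0)
    (hhl : ∀ l, MvPowerSeries.coeff (Finsupp.single l 1) (h : MvPowerSeries (Fin 2) ℝ) = 0)
    (hcurve : ∀ τ : Fin 2 → PowerSeries ℝ, τ j = PowerSeries.X → aeval τ p = 0 →
      aeval τ h ≠ 0) :
    ∃ m, 2 ≤ m ∧ KForm m (MvPowerSeries.X 0 *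
      ((rename Fin.succ p : MvPolynomial (Fin 3) ℝ) : MvPowerSeries (Fin 3) ℝ) +
      ((rename Fin.succ h : MvPolynomial (Fin 3) ℝ) : MvPowerSeries (Fin 3) ℝ)) := by
  classical
  have hcov : ∀ l : Fin 2, l = i ∨ l = j := by
    revert i j; intro i j hij _ _ l; omega
  have hsumij : ∀ φ : Fin 2 → MvPowerSeries (Fin 2) ℝ, ∑ l, φ l = φ i + φ j := by
    intro φ
    have : (Finset.univ : Finset (Fin 2)) = {i, j} := by
      ext l; simpa using hcov l
    rw [this, Finset.sum_pair hij]
  -- the coordinates `(p, X j)`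
  let a : Fin 2 → MvPowerSeries (Fin 2) ℝ :=
    Function.update MvPowerSeries.X i (p : MvPowerSeries (Fin 2) ℝ)
  have hai : a i = p := by simp [a]
  have haj : a j = MvPowerSeries.X j := by simp [a, hij.symm]
  have ha : Params a := by
    have hjm : MvPowerSeries.X j ∈ Ideal.span (Set.range a) :=
      haj ▸ Ideal.subset_span ⟨j, rfl⟩
    have him : (p : MvPowerSeries (Fin 2) ℝ) ∈ Ideal.span (Set.range a) :=
      hai ▸ Ideal.subset_span ⟨i, rfl⟩
    constructor
    · intro l
      rcases hcov l with rfl | rfl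
      · rw [hai, hp0]
      · rw [haj]; simp
    · intro l
      rcases hcov l with rfl | rfl
      · have h1 := mem_span_X _ hp0
        rw [Ideal.mem_span_range_iff_exists_fun] at h1
        obtain ⟨c, hc⟩ := h1
        rw [hsumij] at hc
        have h2 : MvPowerSeries.constantCoeff (c l) ≠ 0 := by
          rw [← hc, map_add, lin_mul, lin_mul, lin_X, lin_X, if_pos rfl, if_neg hij] at hpi
          simpa using hpi
        have h3 : IsUnit (c l) :=
          MvPowerSeries.isUnit_iff_constantCoeff.mpr (isUnit_iff_ne_zero.mpr h2)
        have h4 : c l * MvPowerSeries.X l ∈ Ideal.span (Set.range a) := by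
          rw [← eq_sub_iff_add_eq] at hc
          rw [hc]
          exact Ideal.sub_mem _ him (Ideal.mul_mem_left _ _ hjm)
        exact (Ideal.unit_mul_mem_iff_mem _ h3).mp h4
      · exact hjm
  obtain ⟨e, he⟩ := ift ha
  -- the curve
  let emb : Unit ↪ Fin 2 := ⟨fun _ => j, fun _ _ _ => rfl⟩
  let κ : MvPowerSeries (Fin 2) ℝ →ₐ[ℝ] PowerSeries ℝ :=
    (MvPowerSeries.killCompl (R := ℝ) emb).comp (e.symm : _ →ₐ[ℝ] MvPowerSeries (Fin 2) ℝ)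
  have hκp : κ p = 0 := by
    change MvPowerSeries.killCompl emb (e.symm p) = 0
    rw [← hai, ← he i, AlgEquiv.symm_apply_apply]
    exact MvPowerSeries.killCompl_X_eq_zero (by rintro ⟨x, hx⟩; exact hij.symm hx)
  have hκj : κ (MvPowerSeries.X j) = PowerSeries.X := by
    change MvPowerSeries.killCompl emb (e.symm (MvPowerSeries.X j)) = _
    rw [← haj, ← he j, AlgEquiv.symm_apply_apply]
    exact MvPowerSeries.killCompl_X (R := ℝ) (e := emb) ()
  have hκ0 : ∀ x, MvPowerSeries.constantCoeff x = 0 → PowerSeries.constantCoeff (κ x) = 0 := by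
    intro x hx
    have h1 := constantCoeff_equiv e.symm hx
    change MvPowerSeries.constantCoeff (MvPowerSeries.killCompl emb (e.symm x)) = 0
    rw [← MvPowerSeries.coeff_zero_eq_constantCoeff_apply, MvPowerSeries.coeff_killCompl]
    simpa using h1
  set γ := κ (MvPowerSeries.X i) with hγ
  have hγ0 : PowerSeries.constantCoeff γ = 0 := hκ0 _ (by simp)
  have hκpoly : ∀ q : MvPolynomial (Fin 2) ℝ,
      κ (q : MvPowerSeries (Fin 2) ℝ) = aeval (fun l => κ (MvPowerSeries.X l)) q := by
    intro q
    have := comp_aeval_apply (f := fun l => (MvPowerSeries.X l : MvPowerSeries (Fin 2) ℝ)) κ q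
    rw [← this]
    congr 1
    have h2 := coe_aeval (fun l => (X l : MvPolynomial (Fin 2) ℝ)) q
    simpa using h2
  have hκh : κ h ≠ 0 := by
    rw [hκpoly]
    exact hcurve _ hκj (by rw [← hκpoly, hκp])
  let T : PowerSeries ℝ →ₐ[ℝ] MvPowerSeries (Fin 2) ℝ := PowerSeries.toMvPowerSeries j
  have hTX : T PowerSeries.X = MvPowerSeries.X j := PowerSeries.toMvPowerSeries_X j
  let ℓ : MvPowerSeries (Fin 2) ℝ := MvPowerSeries.X i - T γ
  have hdiv : ∀ q : MvPolynomial (Fin 2) ℝ,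
      ℓ ∣ (q : MvPowerSeries (Fin 2) ℝ) - T (κ q) := by
    intro q
    rw [← Ideal.mem_span_singleton, ← Ideal.Quotient.eq]
    let M := Ideal.Quotient.mkₐ ℝ (Ideal.span {ℓ})
    have : M.comp (coeToMvPowerSeries.algHom (R := ℝ) (σ := Fin 2) ℝ) =
      (M.comp (T.comp κ)).comp (coeToMvPowerSeries.algHom (R := ℝ) (σ := Fin 2) ℝ) := by
      apply MvPolynomial.algHom_ext
      intro l
      simp only [AlgHom.comp_apply, coeToMvPowerSeries.algHom_apply, coe_X, MvPowerSeries.map_X]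
      change Ideal.Quotient.mk _ _ = Ideal.Quotient.mk _ _
      rw [Ideal.Quotient.eq, Ideal.mem_span_singleton]
      rcases hcov l with rfl | rfl
      · exact dvd_rfl
      · rw [hκj, hTX, sub_self]; exact dvd_zero _
    have h2 := DFunLike.congr_fun this q
    change M _ = M _
    simpa [coeToMvPowerSeries.algHom_apply] using h2
  obtain ⟨q1, hq1⟩ := hdiv p
  obtain ⟨h1, hh1⟩ := hdiv h
  rw [hκp, map_zero, sub_zero] at hq1
  have hT0 : ∀ f : PowerSeries ℝ, PowerSeries.constantCoeff f = 0 →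
      MvPowerSeries.coeff (Finsupp.single i 1) (T f) = 0 := by
    intro f hf
    exact PowerSeries.toMvPowerSeries_coeff_eq_zero (by simp [hij.symm]) hf
  have hTc : ∀ f : PowerSeries ℝ, MvPowerSeries.constantCoeff (T f) =
      PowerSeries.constantCoeff f := by
    intro f
    exact MvPowerSeries.constantCoeff_rename _ _
  have hℓ0 : MvPowerSeries.constantCoeff ℓ = 0 := by simp [ℓ, hTc, hγ0]
  have hℓi : MvPowerSeries.coeff (Finsupp.single i 1) ℓ = 1 := by
    simp [ℓ, hT0 _ hγ0, lin_X]
  have hκh0 := hκ0 _ hh0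
  have hq1u : IsUnit q1 := by
    rw [MvPowerSeries.isUnit_iff_constantCoeff, isUnit_iff_ne_zero]
    rw [hq1, lin_mul, hℓ0, hℓi] at hpi
    simpa using hpi
  rw [sub_eq_iff_eq_add] at hh1
  have hh10 : MvPowerSeries.constantCoeff h1 = 0 := by
    have := hhl i
    rw [hh1, map_add, lin_mul, hℓ0, hℓi, hT0 _ hκh0] at this
    simpa using this
  obtain ⟨m, ε, hε, hmε⟩ : ∃ (m : ℕ) (ε : PowerSeries ℝ), IsUnit ε ∧
      κ h = ε * PowerSeries.X ^ m :=
    ⟨_, PowerSeries.divXPowOrder (κ h), by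
      rw [PowerSeries.isUnit_iff_constantCoeff, isUnit_iff_ne_zero, ne_eq,
        PowerSeries.constantCoeff_divXPowOrder_eq_zero_iff]
      exact hκh, by
      rw [mul_comm]; exact PowerSeries.X_pow_order_mul_divXPowOrder.symm⟩
  have hε0 : PowerSeries.constantCoeff ε ≠ 0 :=
    isUnit_iff_ne_zero.mp (PowerSeries.isUnit_iff_constantCoeff.mp hε)
  have hm0 : m ≠ 0 := by
    rintro rfl
    rw [hmε] at hκh0
    simp [hε0] at hκh0
  have hm1 : m ≠ 1 := by
    rintro rfl
    have := hhl j
    rw [hh1, map_add, lin_mul, hℓ0, hh10, hmε, map_mul, pow_one, hTX, lin_mul, lin_X, hTc] at this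
    simp [hε0] at this
  refine ⟨m, by omega, ?_⟩
  -- go to three variables
  let ι : MvPowerSeries (Fin 2) ℝ →ₐ[ℝ] MvPowerSeries (Fin 3) ℝ :=
    MvPowerSeries.rename (R := ℝ) (Fin.succ : Fin 2 → Fin 3)
  have hιc : ∀ q : MvPolynomial (Fin 2) ℝ,
      ((rename Fin.succ q : MvPolynomial (Fin 3) ℝ) : MvPowerSeries (Fin 3) ℝ) = ι q :=
    fun q => (MvPowerSeries.rename_coe _ q).symm
  have hιX : ∀ l, ι (MvPowerSeries.X l) = MvPowerSeries.X l.succ :=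
    fun l => MvPowerSeries.rename_X _ l
  have hι0 : ∀ x, MvPowerSeries.constantCoeff (ι x) = MvPowerSeries.constantCoeff x :=
    fun x => MvPowerSeries.constantCoeff_rename _ x
  rw [hιc, hιc, hh1, hq1, hmε]
  let b : Fin 3 → MvPowerSeries (Fin 3) ℝ :=
    ![ι ℓ, MvPowerSeries.X 0 * ι q1 + ι h1, MvPowerSeries.X j.succ]
  refine ⟨b, ι (T ε), ⟨?_, ?_⟩, (hε.map T).map ι, ?_⟩
  · intro l
    fin_cases l
    · simp [b, hι0, hℓ0]
    · simp [b, hι0, hh10]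
    · simp [b]
  · have b0 : ι ℓ ∈ Ideal.span (Set.range b) := Ideal.subset_span ⟨0, rfl⟩
    have b1 : MvPowerSeries.X 0 * ι q1 + ι h1 ∈ Ideal.span (Set.range b) :=
      Ideal.subset_span ⟨1, rfl⟩
    have b2 : MvPowerSeries.X j.succ ∈ Ideal.span (Set.range b) := Ideal.subset_span ⟨2, rfl⟩
    have bi : MvPowerSeries.X i.succ ∈ Ideal.span (Set.range b) := by
      obtain ⟨γ', hγ'⟩ := PowerSeries.X_dvd_iff.mpr hγ0
      have : MvPowerSeries.X i.succ = ι ℓ + MvPowerSeries.X j.succ * ι (T γ') := by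
        rw [← hιX, ← hιX, ← map_mul, ← hTX, ← map_mul, ← hγ', ← map_add]
        simp [ℓ]
      rw [this]
      exact Ideal.add_mem _ b0 (Ideal.mul_mem_right _ _ b2)
    have bh : ι h1 ∈ Ideal.span (Set.range b) := by
      have h2 := mem_span_X _ hh10
      rw [Ideal.mem_span_range_iff_exists_fun] at h2
      obtain ⟨c, hc⟩ := h2
      rw [hsumij] at hc
      rw [← hc, map_add, map_mul, map_mul, hιX, hιX]
      exact Ideal.add_mem _ (Ideal.mul_mem_left _ _ bi) (Ideal.mul_mem_left _ _ b2)
    intro l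
    refine Fin.cases ?_ (fun l => ?_) l
    · have h3 := Ideal.sub_mem _ b1 bh
      rw [add_sub_cancel_right] at h3
      exact (Ideal.mul_unit_mem_iff_mem _ (hq1u.map ι)).mp h3
    · rcases hcov l with rfl | rfl
      · exact bi
      · exact b2
  · simp only [b, map_add, map_mul, map_pow, hTX, hιX, Matrix.cons_val_zero, Matrix.cons_val_one,
      Matrix.cons_val]
    ring

end Monoid12

namespace Monoid12

theorem const_aeval {σ : Type*} {n : ℕ} (y : σ → MvPowerSeries (Fin n) ℝ)
    (f : MvPolynomial σ ℝ) :
    MvPowerSeries.constantCoeff (aeval y f) =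
      eval (fun s => MvPowerSeries.constantCoeff (y s)) f := by
  induction f using MvPolynomial.induction_on with
  | C a =>
    rw [aeval_C, eval_C]
    exact MvPowerSeries.constantCoeff_C (σ := Fin n) a
  | add p q hp hq => simp only [map_add, hp, hq]
  | mul_X p s hp => simp only [map_mul, hp, aeval_X, eval_X]

theorem lin_aeval {σ : Type*} [Fintype σ] {n : ℕ} (y : σ → MvPowerSeries (Fin n) ℝ)
    (l : Fin n) (f : MvPolynomial σ ℝ) :
    MvPowerSeries.coeff (Finsupp.single l 1) (aeval y f) =
      ∑ s, eval (fun s => MvPowerSeries.constantCoeff (y s)) (pderiv s f) *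
        MvPowerSeries.coeff (Finsupp.single l 1) (y s) := by
  classical
  induction f using MvPolynomial.induction_on with
  | C a =>
    rw [aeval_C]
    simp only [pderiv_C, map_zero, zero_mul, Finset.sum_const_zero]
    exact lin_C l a
  | add p q hp hq => simp only [map_add, hp, hq, add_mul, Finset.sum_add_distrib]
  | mul_X p s hp =>
    rw [map_mul, aeval_X, lin_mul, hp, const_aeval]
    simp only [pderiv_mul, map_add, map_mul, eval_X, add_mul, Finset.sum_add_distrib]
    rw [add_comm]
    congr 1
    · rw [Finset.sum_mul]
      exact Finset.sum_congr rfl fun t _ => by ring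
    · rw [Finset.sum_eq_single s]
      · simp
      · intro t _ hts
        simp [pderiv_X, Pi.single_apply, hts.symm, hts]
      · simp

theorem kform_of_singular {d : ℕ} (hd : 3 ≤ d)
    (f g : MvPolynomial (Fin 3) ℝ)
    (hf : f.IsHomogeneous (d - 1)) (hg : g.IsHomogeneous d) (hf0 : f ≠ 0)
    (hgcd : ∀ q : MvPolynomial (Fin 3) ℝ, q ∣ f → q ∣ g → IsUnit q)
    (hnocsing : ∀ b : Fin 3 → ℝ, b ≠ 0 →
      ¬((eval b f = 0 ∧ ∀ j, eval b (pderiv j f) = 0) ∧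
        (eval b g = 0 ∧ ∀ j, eval b (pderiv j g) = 0)))
    (P : Fin 4 → ℝ) (k : Fin 3) (hk : P k.succ ≠ 0)
    (hF : (X 0 * rename Fin.succ f + rename Fin.succ g :
      MvPolynomial (Fin 4) ℝ).IsHomogeneous d)
    (hs0 : eval P (X 0 * rename Fin.succ f + rename Fin.succ g) = 0)
    (hs : ∀ i, eval P (pderiv i (X 0 * rename Fin.succ f + rename Fin.succ g)) = 0) :
    ∃ m, 2 ≤ m ∧ KForm m (localEq (X 0 * rename Fin.succ f + rename Fin.succ g) P k.succ :
      MvPowerSeries (Fin 3) ℝ) := by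
  classical
  let β : Fin 3 → ℝ := fun s => P s.succ / P k.succ
  let c : ℝ := P 0 / P k.succ
  have hβk : β k = 1 := div_self hk
  have hscale : ∀ {D : ℕ} (G : MvPolynomial (Fin 4) ℝ), G.IsHomogeneous D → eval P G = 0 →
      eval (fun i => P i / P k.succ) G = 0 := by
    intro D G hG h0
    have := aeval_smul_homog hG (P k.succ)⁻¹ P
    change eval _ G = _ * eval _ G at this
    rw [h0, mul_zero] at this
    rw [← this]
    congr 2
    funext i
    rw [div_eq_inv_mul]
  have h0 := hscale _ hF hs0
  have h1 := fun i => hscale _ (hF.pderiv (i := i)) (hs i)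
  have hev : ∀ q : MvPolynomial (Fin 3) ℝ,
      eval (fun i => P i / P k.succ) (rename Fin.succ q) = eval β q := by
    intro q; rw [eval_rename]; rfl
  have hpd0 : ∀ q : MvPolynomial (Fin 3) ℝ, pderiv (0 : Fin 4) (rename Fin.succ q) = 0 := by
    intro q
    induction q using MvPolynomial.induction_on with
    | C a => simp
    | add p q hp hq => simp [hp, hq]
    | mul_X p s hp => simp [hp, pderiv_X, pderiv_mul]
  have hfβ : eval β f = 0 := by
    have := h1 0
    rw [map_add, pderiv_mul, hpd0, hpd0, pderiv_X_self] at this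
    simpa [hev] using this
  have hgβ : eval β g = 0 := by
    simpa [hev, hfβ] using h0
  have hfg : ∀ s, c * eval β (pderiv s f) + eval β (pderiv s g) = 0 := by
    intro s
    have := h1 s.succ
    rw [map_add, pderiv_mul, pderiv_rename (Fin.succ_injective _),
      pderiv_rename (Fin.succ_injective _), pderiv_X_of_ne (Fin.succ_ne_zero s).symm] at this
    simpa [hev] using this
  have hβ0 : β ≠ 0 := fun h => by rw [h] at hβk; simp at hβk
  have hex : ∃ s, eval β (pderiv s f) ≠ 0 := by
    by_contra! hcon
    exact hnocsing β hβ0 ⟨⟨hfβ, hcon⟩, hgβ, fun s => by simpa [hcon] using hfg s⟩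
  obtain ⟨i, hi⟩ : ∃ i : Fin 2, eval β (pderiv (k.succAbove i) f) ≠ 0 := by
    by_contra! hcon
    have he := congrArg (eval β) hf.sum_X_mul_pderiv
    rw [Fin.sum_univ_succAbove _ k] at he
    simp [hcon, hβk, hfβ] at he
    obtain ⟨s, hs⟩ := hex
    rcases Fin.eq_self_or_eq_succAbove k s with rfl | ⟨l, rfl⟩
    · exact hs he
    · exact hs (hcon l)
  obtain ⟨j, hij⟩ : ∃ j : Fin 2, i ≠ j := by
    clear hi; revert i; decide
  let x : Fin 3 → MvPolynomial (Fin 2) ℝ :=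
    k.succAboveCases 1 (fun l => C (β (k.succAbove l)) + X l)
  have hxk : x k = 1 := by simp [x]
  have hxl : ∀ l, x (k.succAbove l) = C (β (k.succAbove l)) + X l := by intro l; simp [x]
  have hxc : (fun s => MvPowerSeries.constantCoeff
      ((x s : MvPolynomial (Fin 2) ℝ) : MvPowerSeries (Fin 2) ℝ)) = β := by
    funext s
    rcases Fin.eq_self_or_eq_succAbove k s with rfl | ⟨l, rfl⟩
    · rw [hxk, hβk]; simp
    · rw [hxl]; simp
  have hlin : ∀ (q : MvPolynomial (Fin 3) ℝ) (l : Fin 2),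
      MvPowerSeries.coeff (Finsupp.single l 1)
        ((aeval x q : MvPolynomial (Fin 2) ℝ) : MvPowerSeries (Fin 2) ℝ) =
        eval β (pderiv (k.succAbove l) q) := by
    intro q l
    rw [coe_aeval, lin_aeval, hxc, Fin.sum_univ_succAbove _ k, hxk]
    have h3 : ∀ t : Fin 2, MvPowerSeries.coeff (Finsupp.single l 1)
        ((x (k.succAbove t) : MvPolynomial (Fin 2) ℝ) : MvPowerSeries (Fin 2) ℝ) =
        if l = t then 1 else 0 := by
      intro t
      rw [hxl, coe_add, coe_C, coe_X, map_add, lin_C, lin_X, zero_add]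
    have h4 : MvPowerSeries.coeff (Finsupp.single l 1)
        ((1 : MvPolynomial (Fin 2) ℝ) : MvPowerSeries (Fin 2) ℝ) = 0 := by
      rw [← C_1, coe_C, lin_C]
    rw [h4]
    simp [h3]
  have hcon : ∀ q : MvPolynomial (Fin 3) ℝ, MvPowerSeries.constantCoeff
        ((aeval x q : MvPolynomial (Fin 2) ℝ) : MvPowerSeries (Fin 2) ℝ) = eval β q := by
    intro q
    rw [coe_aeval, const_aeval, hxc]
  obtain ⟨m, hm, hK⟩ := split_lemma (aeval x f) (C c * aeval x f + aeval x g) i j hij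
    (by rw [hcon, hfβ]) (by rw [hlin]; exact hi)
    (by rw [coe_add, coe_mul, map_add, map_mul, hcon, hcon, hfβ, hgβ]; simp)
    (by
      intro l
      rw [coe_add, coe_mul, coe_C, map_add, lin_mul, lin_C, hlin, hlin,
        MvPowerSeries.constantCoeff_C, zero_mul, add_zero]
      exact hfg _)
    (by
      intro τ hτ hp hh
      have hcomp : ∀ q : MvPolynomial (Fin 3) ℝ,
          aeval τ (aeval x q) = aeval (fun s => aeval τ (x s)) q :=
        fun q => comp_aeval_apply (f := x) (aeval τ) q
      rw [map_add, map_mul, hp, mul_zero, zero_add] at hh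
      rw [hcomp] at hp hh
      refine curve_contra hf0 (fun q h1 h2 => hgcd q h1 h2) hf hg _ k (k.succAbove j)
        (Fin.succAbove_ne k j).symm (β (k.succAbove j)) ?_ ?_ hp hh
      · simp only [hxk, map_one]
      · simp only [hxl, map_add, aeval_X, hτ, aeval_C]
        rfl)
  refine ⟨m, hm, ?_⟩
  have hren : ∀ q : MvPolynomial (Fin 3) ℝ,
      aeval (k.succ.succAboveCases (1 : MvPolynomial (Fin 3) ℝ)
        (fun j => C (P (k.succ.succAbove j) / P k.succ) + X j)) (rename Fin.succ q) =
      rename Fin.succ (aeval x q) := by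
    intro q
    rw [aeval_rename, comp_aeval_apply]
    congr 2
    funext s
    rcases Fin.eq_self_or_eq_succAbove k s with rfl | ⟨l, rfl⟩
    · simp [hxk]
    · rw [hxl, Function.comp_apply, ← Fin.succ_succAbove_succ]
      refine (Fin.insertNth_apply_succAbove (α := fun _ => MvPolynomial (Fin 3) ℝ)
        k.succ _ _ _).trans ?_
      simp [β]
  have hX0 : aeval (k.succ.succAboveCases (1 : MvPolynomial (Fin 3) ℝ)
        (fun j => C (P (k.succ.succAbove j) / P k.succ) + X j)) (X 0 : MvPolynomial (Fin 4) ℝ) =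
      C c + X 0 := by
    rw [aeval_X]
    have h5 := Fin.insertNth_apply_succAbove (α := fun _ => MvPolynomial (Fin 3) ℝ) k.succ 1
      (fun j => C (P (k.succ.succAbove j) / P k.succ) + X j) (0 : Fin 3)
    simp only [Fin.succ_succAbove_zero] at h5
    refine Eq.trans h5 ?_
    rfl
  convert hK using 1
  rw [localEq, map_add, map_mul, hren, hren, hX0]
  simp only [map_add, map_mul, rename_C, coe_add, coe_mul, coe_X, coe_C]
  ring

end Monoid12

/-- every real singular point other than `O = (1:0:0:0)` of a real normalized
non-degenerate monoid surface is of real type `A⁻`: the local equation (in any chart, up to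
sign) has real normal form `x₁² − x₂² + x₃^{n+1}` for some `n ≥ 1`. -/
theorem stmt12 {d : ℕ} (hd : 3 ≤ d)
    (f g : MvPolynomial (Fin 3) ℝ)
    (hf : f.IsHomogeneous (d - 1)) (hg : g.IsHomogeneous d) (hf0 : f ≠ 0) (hg0 : g ≠ 0)
    (hgcd : ∀ q : MvPolynomial (Fin 3) ℝ, q ∣ f → q ∣ g → IsUnit q)
    (hnocsing : ∀ b : Fin 3 → ℝ, b ≠ 0 →
      ¬((eval b f = 0 ∧ ∀ j, eval b (pderiv j f) = 0) ∧
        (eval b g = 0 ∧ ∀ j, eval b (pderiv j g) = 0)))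
    (P : Fin 4 → ℝ) (hPO : (P ∘ Fin.succ) ≠ 0)
    (hsing : SingularAt (X 0 * rename Fin.succ f + rename Fin.succ g) P) :
    ∃ n : ℕ, 1 ≤ n ∧ ∀ r : Fin 4, P r ≠ 0 →
      (RightEquivR (localEq (X 0 * rename Fin.succ f + rename Fin.succ g) P r)
          ((MvPowerSeries.X 0) ^ 2 - (MvPowerSeries.X 1) ^ 2 +
            (MvPowerSeries.X 2) ^ (n + 1)) ∨
        RightEquivR (localEq (X 0 * rename Fin.succ f + rename Fin.succ g) P r)
          (-((MvPowerSeries.X 0) ^ 2 - (MvPowerSeries.X 1) ^ 2 +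
            (MvPowerSeries.X 2) ^ (n + 1)))) := by
  obtain ⟨k, hk⟩ := Function.ne_iff.mp hPO
  have hF : (X 0 * rename Fin.succ f + rename Fin.succ g :
      MvPolynomial (Fin 4) ℝ).IsHomogeneous d := by
    refine IsHomogeneous.add ?_ hg.rename_isHomogeneous
    have := (isHomogeneous_X ℝ (0 : Fin 4)).mul (hf.rename_isHomogeneous (f := Fin.succ))
    rwa [show 1 + (d - 1) = d by omega] at this
  obtain ⟨m, hm, hK⟩ := Monoid12.kform_of_singular hd f g hf hg hf0 hgcd hnocsing P k hk hF
    hsing.1 hsing.2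
  obtain ⟨n, rfl⟩ : ∃ n, m = n + 1 := ⟨m - 1, by omega⟩
  exact ⟨n, by omega, fun r hr =>
    Monoid12.KForm.normal (Nat.succ_ne_zero n) (Monoid12.chart_transport hF P hk hr hK)⟩
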